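/- (Lemma 2.3, energy estimate for the even reflection) Let s ∈ (0,1) and a < T be real numbers, and let f : [a,T] → ℝ be continuous. Define F : ℝ → ℝ by F(t) = 0 for t < a, F(t) = f(t) for a ≤ t ≤ T, F(t) = f(2T−t) for T < t ≤ 2T−a, and F(t) = 0 for t > 2T−a (i.e., extend f by zero on (−∞,a) and reflect evenly across T). Then there exists a constant C > 0 depending only on s such that ∫_ℝ∫_ℝ |F(t)−F(τ)|² / |t−τ|^{1+s} dτ dt ≤ C ( ∫_a^T ∫_a^t |f(t)−f(τ)|² / (t−τ)^{1+s} dτ dt + ∫_a^T |f(t)|² / (T−t)^s dt ). -/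

import Mathlib

open MeasureTheory Real Set
open scoped ENNReal NNReal

noncomputable section

/-- The extension of `f : [a,T] → ℝ` by zero on `(-∞,a)`, reflected evenly across `T`,
and zero on `(2T-a, ∞)`. -/
def evenReflectExtend (a T : ℝ) (f : ℝ → ℝ) : ℝ → ℝ := fun t =>
  if t < a then 0
  else if t ≤ T then f t
  else if t ≤ 2 * T - a then f (2 * T - t)
  else 0


theorem lintegral_comp_min_reflection (T : ℝ) (h : ℝ → ℝ≥0∞) :
    ∫⁻ t, h (min t (2 * T - t)) = 2 * ∫⁻ t in Iio T, h t := by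
  have hl : ∫⁻ t in Iio T, h (min t (2 * T - t)) = ∫⁻ t in Iio T, h t := by
    refine setLIntegral_congr_fun measurableSet_Iio fun t ht => ?_
    have ht' : t < T := ht
    simp only [min_eq_left (by linarith : t ≤ 2 * T - t)]
  have hr : ∫⁻ t in Ici T, h (min t (2 * T - t)) = ∫⁻ t in Iio T, h t := by
    have h₁ : ∫⁻ t in Ici T, h (min t (2 * T - t)) = ∫⁻ t in Ioi T, h (2 * T - t) := by
      rw [setLIntegral_congr (Ioi_ae_eq_Ici (μ := volume) (a := T)).symm]
      refine setLIntegral_congr_fun measurableSet_Ioi fun t ht => ?_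
      have ht' : T < t := ht
      simp only [min_eq_right (by linarith : 2 * T - t ≤ t)]
    have hp : (fun t : ℝ => 2 * T - t) ⁻¹' Iio T = Ioi T := by
      ext t
      simp only [mem_preimage, mem_Iio, mem_Ioi]
      constructor <;> intro <;> linarith
    rw [h₁, ← hp]
    exact (Measure.measurePreserving_sub_left volume (2 * T)).setLIntegral_comp_preimage_emb
      (MeasurableEquiv.subLeft (2 * T)).measurableEmbedding h (Iio T)
  rw [← lintegral_add_compl _ (measurableSet_Iio (a := T)), compl_Iio, hl, hr, two_mul]

theorem setLIntegral_inter_Iio_eq_indicator (S : Set ℝ) (h : ℝ → ℝ → ℝ≥0∞) (t : ℝ) :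
    ∫⁻ τ in S ∩ Iio t, h t τ
      = ∫⁻ τ in S, {p : ℝ × ℝ | p.2 < p.1}.indicator (Function.uncurry h) (t, τ) := by
  rw [inter_comm, ← Measure.restrict_restrict measurableSet_Iio,
    ← lintegral_indicator measurableSet_Iio]
  rfl

theorem setLIntegral_inter_Iio_swap (S : Set ℝ) {h : ℝ → ℝ → ℝ≥0∞}
    (hh : Measurable (Function.uncurry h)) :
    ∫⁻ t in S, ∫⁻ τ in S ∩ Iio t, h t τ = ∫⁻ τ in S, ∫⁻ t in S ∩ Ioi τ, h t τ := by
  have hr : ∀ τ, ∫⁻ t in S ∩ Ioi τ, h t τ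
      = ∫⁻ t in S, {p : ℝ × ℝ | p.2 < p.1}.indicator (Function.uncurry h) (t, τ) := by
    intro τ
    rw [inter_comm, ← Measure.restrict_restrict measurableSet_Ioi,
      ← lintegral_indicator measurableSet_Ioi]
    rfl
  simp_rw [setLIntegral_inter_Iio_eq_indicator, hr]
  exact lintegral_lintegral_swap
    (hh.indicator (measurableSet_lt measurable_snd measurable_fst)).aemeasurable

theorem measurable_setLIntegral_inter_Iio (S : Set ℝ) {h : ℝ → ℝ → ℝ≥0∞}
    (hh : Measurable (Function.uncurry h)) :
    Measurable fun t => ∫⁻ τ in S ∩ Iio t, h t τ := by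
  simp_rw [setLIntegral_inter_Iio_eq_indicator]
  exact (hh.indicator (measurableSet_lt measurable_snd measurable_fst)).lintegral_prod_right'

theorem setLIntegral_symm_eq_two_mul (S : Set ℝ) {h : ℝ → ℝ → ℝ≥0∞}
    (hh : Measurable (Function.uncurry h)) (hsymm : ∀ t τ, h t τ = h τ t) :
    ∫⁻ t in S, ∫⁻ τ in S, h t τ = 2 * ∫⁻ t in S, ∫⁻ τ in S ∩ Iio t, h t τ := by
  have hsplit : ∀ t, ∫⁻ τ in S, h t τ
      = (∫⁻ τ in S ∩ Iio t, h t τ) + ∫⁻ τ in S ∩ Ioi t, h t τ := by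
    intro t
    rw [← lintegral_inter_add_sdiff (fun τ => h t τ) S (measurableSet_Iio (a := t)),
      sdiff_eq, compl_Iio]
    congr 1
    exact setLIntegral_congr ((ae_eq_refl S).inter (Ioi_ae_eq_Ici (μ := volume) (a := t)).symm)
  have hswap : ∫⁻ t in S, ∫⁻ τ in S ∩ Ioi t, h t τ = ∫⁻ t in S, ∫⁻ τ in S ∩ Iio t, h t τ := by
    rw [setLIntegral_inter_Iio_swap S hh]
    simp_rw [hsymm]
  simp_rw [hsplit]
  rw [lintegral_add_left (measurable_setLIntegral_inter_Iio S hh), two_mul, hswap]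

theorem lintegral_Ioi_sub_rpow {s : ℝ} (hs : 0 < s) {a c : ℝ} (hac : a < c) :
    ∫⁻ t in Ioi c, ENNReal.ofReal ((t - a) ^ (-(1 + s)))
      = ENNReal.ofReal ((c - a) ^ (-s) / s) := by
  have hca : 0 < c - a := sub_pos.2 hac
  have hp : (fun t : ℝ => t - a) ⁻¹' Ioi (c - a) = Ioi c := by
    ext t
    simp
  rw [← hp, (measurePreserving_sub_right volume a).setLIntegral_comp_preimage_emb
    (MeasurableEquiv.subRight a).measurableEmbedding
    (fun x => ENNReal.ofReal (x ^ (-(1 + s)))) (Ioi (c - a)),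
    ← ofReal_integral_eq_lintegral_ofReal
      (integrableOn_Ioi_rpow_of_lt (by linarith) hca)]
  · rw [integral_Ioi_rpow_of_lt (by linarith) hca]
    congr 1
    rw [show -(1 + s) + 1 = -s by ring, neg_div_neg_eq]
  · filter_upwards [ae_restrict_mem measurableSet_Ioi] with x hx
    exact rpow_nonneg (hca.trans hx).le _

theorem lintegral_Iio_sub_rpow {s : ℝ} (hs : 0 < s) {a t : ℝ} (hat : a < t) :
    ∫⁻ τ in Iio a, ENNReal.ofReal ((t - τ) ^ (-(1 + s)))
      = ENNReal.ofReal ((t - a) ^ (-s) / s) := by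
  have hp : (fun τ : ℝ => t - τ) ⁻¹' Ioi (t - a) = Iio a := by
    ext τ
    simp
  rw [← hp, (Measure.measurePreserving_sub_left volume t).setLIntegral_comp_preimage_emb
    (MeasurableEquiv.subLeft t).measurableEmbedding
    (fun x => ENNReal.ofReal (x ^ (-(1 + s)))) (Ioi (t - a))]
  simpa using lintegral_Ioi_sub_rpow hs (sub_pos.2 hat)


theorem lintegral_weight_mul_inv_le {s : ℝ} (hs : 0 < s) {a T τ w : ℝ} (hw : 0 ≤ w)
    (haτ : a < τ) (hτT : τ < T) :
    ENNReal.ofReal s⁻¹ * ENNReal.ofReal (w * (τ - a) ^ (-s)) ≤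
      (∫⁻ t in Ioo τ T, ENNReal.ofReal (w * (t - a) ^ (-(1 + s))))
        + ENNReal.ofReal s⁻¹ * ENNReal.ofReal (w / (T - τ) ^ s) := by
  have hsplit := lintegral_inter_add_sdiff
    (fun t => ENNReal.ofReal ((t - a) ^ (-(1 + s)))) (Ioi τ) (measurableSet_Iio (a := T))
    (μ := volume)
  rw [Ioi_inter_Iio, sdiff_eq, compl_Iio, inter_eq_right.2 (Ici_subset_Ioi.2 hτT),
    ← setLIntegral_congr (Ioi_ae_eq_Ici (μ := volume) (a := T)),
    lintegral_Ioi_sub_rpow hs haτ, lintegral_Ioi_sub_rpow hs (haτ.trans hτT)] at hsplit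
  calc ENNReal.ofReal s⁻¹ * ENNReal.ofReal (w * (τ - a) ^ (-s))
      = ENNReal.ofReal w * ENNReal.ofReal ((τ - a) ^ (-s) / s) := by
        rw [← ENNReal.ofReal_mul (by positivity), ← ENNReal.ofReal_mul hw]
        congr 1
        ring
    _ = (∫⁻ t in Ioo τ T, ENNReal.ofReal (w * (t - a) ^ (-(1 + s))))
        + ENNReal.ofReal w * ENNReal.ofReal ((T - a) ^ (-s) / s) := by
        simp_rw [ENNReal.ofReal_mul hw]
        rw [← hsplit, mul_add, lintegral_const_mul _ (by fun_prop)]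
    _ ≤ _ := by
        refine add_le_add_right ?_ _
        rw [← ENNReal.ofReal_mul hw, ← ENNReal.ofReal_mul (by positivity)]
        apply ENNReal.ofReal_le_ofReal
        have h₁ : (T - a) ^ (-s) ≤ (T - τ) ^ (-s) :=
          rpow_le_rpow_of_nonpos (by linarith) (by linarith) (by linarith)
        rw [rpow_neg (by linarith : 0 ≤ T - τ)] at h₁
        calc w * ((T - a) ^ (-s) / s) = s⁻¹ * (w * (T - a) ^ (-s)) := by ring
          _ ≤ s⁻¹ * (w * ((T - τ) ^ s)⁻¹) := by gcongr
          _ = _ := by rw [div_eq_mul_inv]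

theorem lintegral_sq_mul_rpow_lt_top {s : ℝ} (hs1 : s < 1) {a T M : ℝ} (haT : a < T)
    {g : ℝ → ℝ} (hM : ∀ t, |g t| ≤ M) :
    ∫⁻ t in Ioo a T, ENNReal.ofReal (g t ^ 2 * (t - a) ^ (-s)) < ∞ := by
  have hint : IntegrableOn (fun t => M ^ 2 * (t - a) ^ (-s)) (Ioo a T) := by
    have h₀ := (intervalIntegral.intervalIntegrable_rpow' (a := 0) (b := T - a)
      (by linarith : -1 < -s)).comp_sub_right a
    rw [zero_add, sub_add_cancel, intervalIntegrable_iff_integrableOn_Ioo_of_le haT.le] at h₀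
    exact h₀.const_mul _
  refine lt_of_le_of_lt (setLIntegral_mono' measurableSet_Ioo fun t ht => ?_)
    hint.lintegral_lt_top
  have h₁ : 0 ≤ (t - a) ^ (-s) := rpow_nonneg (sub_pos.2 ht.1).le _
  have h₂ : g t ^ 2 ≤ M ^ 2 := sq_le_sq.2 ((hM t).trans (le_abs_self M))
  gcongr

theorem sq_mul_rpow_le {s : ℝ} (hs0 : 0 < s) (hs1 : s < 1) {a t τ : ℝ} (haτ : a < τ)
    (hτt : τ < t) (x y : ℝ) :
    y ^ 2 * (t - a) ^ (-(1 + s)) ≤ (1 + s) / (2 * s) * (x ^ 2 * (t - a) ^ (-(1 + s)))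
      + (1 + s) / (1 - s) * ((x - y) ^ 2 / |t - τ| ^ (1 + s)) := by
  have h1s : 0 < 1 - s := by linarith
  have hy : y ^ 2 ≤ (1 + s) / (2 * s) * x ^ 2 + (1 + s) / (1 - s) * (x - y) ^ 2 := by
    have hid : (1 + s) / (2 * s) * x ^ 2 + (1 + s) / (1 - s) * (x - y) ^ 2 - y ^ 2
        = ((1 - s) * x + 2 * s * (x - y)) ^ 2 / (2 * s * (1 - s)) := by
      field_simp
      ring
    have : 0 ≤ ((1 - s) * x + 2 * s * (x - y)) ^ 2 / (2 * s * (1 - s)) := by positivity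
    linarith
  have hpow : (t - a) ^ (-(1 + s)) ≤ (|t - τ| ^ (1 + s))⁻¹ := by
    rw [abs_of_pos (sub_pos.2 hτt), ← rpow_neg (sub_pos.2 hτt).le]
    exact rpow_le_rpow_of_nonpos (by linarith) (by linarith) (by linarith)
  have hnn : 0 ≤ (t - a) ^ (-(1 + s)) := rpow_nonneg (by linarith) _
  calc y ^ 2 * (t - a) ^ (-(1 + s))
      ≤ ((1 + s) / (2 * s) * x ^ 2 + (1 + s) / (1 - s) * (x - y) ^ 2)
          * (t - a) ^ (-(1 + s)) := by gcongr
    _ = (1 + s) / (2 * s) * (x ^ 2 * (t - a) ^ (-(1 + s)))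
          + (1 + s) / (1 - s) * ((x - y) ^ 2 * (t - a) ^ (-(1 + s))) := by ring
    _ ≤ _ := by
        rw [div_eq_mul_inv ((x - y) ^ 2)]
        gcongr

theorem measurable_uncurry_energy_kernel (s : ℝ) {g : ℝ → ℝ} (hg : Measurable g) :
    Measurable (Function.uncurry fun t τ =>
      ENNReal.ofReal ((g t - g τ) ^ 2 / |t - τ| ^ (1 + s))) := by
  have h₁ : Measurable fun p : ℝ × ℝ => g p.1 := hg.comp measurable_fst
  have h₂ : Measurable fun p : ℝ × ℝ => g p.2 := hg.comp measurable_snd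
  have h₃ : Measurable fun p : ℝ × ℝ => |p.1 - p.2| :=
    (continuous_abs.comp (continuous_fst.sub continuous_snd)).measurable
  exact (((h₁.sub h₂).pow_const 2).div (h₃.pow_const (1 + s))).ennreal_ofReal

theorem hardy_left_endpoint_le {s : ℝ} (hs0 : 0 < s) (hs1 : s < 1) {a T M : ℝ} (haT : a < T)
    {g : ℝ → ℝ} (hg : Measurable g) (hM : ∀ t, |g t| ≤ M) :
    ENNReal.ofReal ((1 - s) / (2 * s)) *
        ∫⁻ t in Ioo a T, ENNReal.ofReal (g t ^ 2 * (t - a) ^ (-s)) ≤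
      ENNReal.ofReal ((1 + s) / (1 - s)) *
          (∫⁻ t in Ioo a T, ∫⁻ τ in Ioo a t,
            ENNReal.ofReal ((g t - g τ) ^ 2 / |t - τ| ^ (1 + s)))
        + ENNReal.ofReal s⁻¹ *
          ∫⁻ t in Ioo a T, ENNReal.ofReal (g t ^ 2 / (T - t) ^ s) := by
  have h1s : 0 < 1 - s := by linarith
  set A := ∫⁻ t in Ioo a T, ENNReal.ofReal (g t ^ 2 * (t - a) ^ (-s)) with hA
  have hAtop : A ≠ ∞ := (lintegral_sq_mul_rpow_lt_top hs1 haT hM).ne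
  have hIio : ∀ t ∈ Ioo a T, Ioo a T ∩ Iio t = Ioo a t := fun t ht => by
    rw [Ioo_inter_Iio, min_eq_right ht.2.le]
  have hIoi : ∀ τ ∈ Ioo a T, Ioo a T ∩ Ioi τ = Ioo τ T := fun τ hτ => by
    rw [Ioo_inter_Ioi, max_eq_right hτ.1.le]
  have hker : Measurable (Function.uncurry fun t τ : ℝ =>
      ENNReal.ofReal (g τ ^ 2 * (t - a) ^ (-(1 + s)))) := by
    have h₂ : Measurable fun p : ℝ × ℝ => g p.2 := hg.comp measurable_snd
    have h₃ : Measurable fun p : ℝ × ℝ => p.1 - a := measurable_fst.sub_const a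
    exact ((h₂.pow_const 2).mul (h₃.pow_const _)).ennreal_ofReal
  have hlower : ENNReal.ofReal s⁻¹ * A ≤
      (∫⁻ τ in Ioo a T, ∫⁻ t in Ioo a T ∩ Ioi τ,
          ENNReal.ofReal (g τ ^ 2 * (t - a) ^ (-(1 + s))))
        + ENNReal.ofReal s⁻¹ *
          ∫⁻ t in Ioo a T, ENNReal.ofReal (g t ^ 2 / (T - t) ^ s) := by
    have hm : Measurable fun τ => ENNReal.ofReal (g τ ^ 2 / (T - τ) ^ s) := by fun_prop
    rw [hA, ← lintegral_const_mul _ (by fun_prop), ← lintegral_const_mul _ hm,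
      ← lintegral_add_right _ (hm.const_mul _)]
    refine setLIntegral_mono' measurableSet_Ioo fun τ hτ => ?_
    rw [hIoi τ hτ]
    exact lintegral_weight_mul_inv_le hs0 (sq_nonneg _) hτ.1 hτ.2
  have hupper : (∫⁻ τ in Ioo a T, ∫⁻ t in Ioo a T ∩ Ioi τ,
          ENNReal.ofReal (g τ ^ 2 * (t - a) ^ (-(1 + s)))) ≤
      ENNReal.ofReal ((1 + s) / (2 * s)) * A + ENNReal.ofReal ((1 + s) / (1 - s)) *
        ∫⁻ t in Ioo a T, ∫⁻ τ in Ioo a t,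
          ENNReal.ofReal ((g t - g τ) ^ 2 / |t - τ| ^ (1 + s)) := by
    rw [← setLIntegral_inter_Iio_swap _ hker, hA, ← lintegral_const_mul _ (by fun_prop),
      ← lintegral_const_mul' _ _ ENNReal.ofReal_ne_top,
      ← lintegral_add_left (by fun_prop)]
    refine setLIntegral_mono' measurableSet_Ioo fun t ht => ?_
    have hta : 0 < t - a := sub_pos.2 ht.1
    rw [hIio t ht]
    calc ∫⁻ τ in Ioo a t, ENNReal.ofReal (g τ ^ 2 * (t - a) ^ (-(1 + s)))
        ≤ ∫⁻ τ in Ioo a t,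
            (ENNReal.ofReal ((1 + s) / (2 * s) * (g t ^ 2 * (t - a) ^ (-(1 + s))))
              + ENNReal.ofReal ((1 + s) / (1 - s)) *
                ENNReal.ofReal ((g t - g τ) ^ 2 / |t - τ| ^ (1 + s))) := by
          refine setLIntegral_mono' measurableSet_Ioo fun τ hτ => ?_
          rw [← ENNReal.ofReal_mul (by positivity), ← ENNReal.ofReal_add (by positivity)
            (by positivity)]
          exact ENNReal.ofReal_le_ofReal (sq_mul_rpow_le hs0 hs1 hτ.1 hτ.2 _ _)
      _ = _ := by
          rw [lintegral_add_left measurable_const, setLIntegral_const, Real.volume_Ioo,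
            lintegral_const_mul' _ _ ENNReal.ofReal_ne_top,
            ← ENNReal.ofReal_mul (by positivity), ← ENNReal.ofReal_mul (by positivity)]
          congr 2
          rw [show -s = -(1 + s) + 1 by ring, rpow_add_one hta.ne']
          ring
  have hsum : ENNReal.ofReal s⁻¹
      = ENNReal.ofReal ((1 + s) / (2 * s)) + ENNReal.ofReal ((1 - s) / (2 * s)) := by
    rw [← ENNReal.ofReal_add (by positivity) (by positivity)]
    congr 1
    field_simp
    ring
  refine ENNReal.le_of_add_le_add_left
    (ENNReal.mul_ne_top (ENNReal.ofReal_ne_top (r := (1 + s) / (2 * s))) hAtop) ?_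
  rw [← add_mul, ← hsum, ← add_assoc]
  exact hlower.trans (by gcongr)

theorem evenReflectExtend_eq_indicator {a T : ℝ} (haT : a ≤ T) (f : ℝ → ℝ) (t : ℝ) :
    evenReflectExtend a T f t = (Icc a T).indicator f (min t (2 * T - t)) := by
  unfold evenReflectExtend
  rcases le_or_gt t T with h | h
  · rw [min_eq_left (by linarith)]
    by_cases ha : t < a
    · rw [if_pos ha, indicator_of_notMem (fun hm => ha.not_ge hm.1)]
    · rw [if_neg ha, if_pos h, indicator_of_mem (mem_Icc.2 ⟨not_lt.1 ha, h⟩)]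
  · rw [min_eq_right (by linarith), if_neg (haT.trans_lt h).le.not_gt, if_neg h.not_ge]
    by_cases ha : t ≤ 2 * T - a
    · rw [if_pos ha, indicator_of_mem (mem_Icc.2 ⟨by linarith, by linarith⟩)]
    · rw [if_neg ha, indicator_of_notMem (fun hm => ha (by linarith [hm.1]))]

theorem lintegral_energy_comp_reflection_le {s : ℝ} (hs : 0 < s) (T : ℝ) (g : ℝ → ℝ) :
    (∫⁻ t, ∫⁻ τ, ENNReal.ofReal ((g (min t (2 * T - t)) - g (min τ (2 * T - τ))) ^ 2
        / |t - τ| ^ (1 + s))) ≤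
      4 * ∫⁻ t in Iio T, ∫⁻ τ in Iio T,
        ENNReal.ofReal ((g t - g τ) ^ 2 / |t - τ| ^ (1 + s)) := by
  have hcontr : ∀ t τ : ℝ, |min t (2 * T - t) - min τ (2 * T - τ)| ≤ |t - τ| := by
    intro t τ
    have h := abs_min_sub_min_le_max t (2 * T - t) τ (2 * T - τ)
    rwa [show 2 * T - t - (2 * T - τ) = -(t - τ) by ring, abs_neg, max_self] at h
  have hpt : ∀ t τ : ℝ, ENNReal.ofReal ((g (min t (2 * T - t)) - g (min τ (2 * T - τ))) ^ 2
        / |t - τ| ^ (1 + s)) ≤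
      ENNReal.ofReal ((g (min t (2 * T - t)) - g (min τ (2 * T - τ))) ^ 2
        / |min t (2 * T - t) - min τ (2 * T - τ)| ^ (1 + s)) := by
    intro t τ
    apply ENNReal.ofReal_le_ofReal
    rcases eq_or_ne (min t (2 * T - t)) (min τ (2 * T - τ)) with h | h
    · simp [h]
    · have := abs_pos.2 (sub_ne_zero.2 h)
      exact div_le_div_of_nonneg_left (sq_nonneg _) (rpow_pos_of_pos this _)
        (rpow_le_rpow this.le (hcontr t τ) (by linarith))
  calc _ ≤ ∫⁻ t, ∫⁻ τ, ENNReal.ofReal ((g (min t (2 * T - t)) - g (min τ (2 * T - τ))) ^ 2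
        / |min t (2 * T - t) - min τ (2 * T - τ)| ^ (1 + s)) :=
        lintegral_mono fun t => lintegral_mono fun τ => hpt t τ
    _ = _ := by
      rw [lintegral_comp_min_reflection T fun t => ∫⁻ τ,
        ENNReal.ofReal ((g t - g (min τ (2 * T - τ))) ^ 2 / |t - min τ (2 * T - τ)| ^ (1 + s))]
      simp_rw [fun t => lintegral_comp_min_reflection T fun τ =>
        ENNReal.ofReal ((g t - g τ) ^ 2 / |t - τ| ^ (1 + s))]
      rw [lintegral_const_mul' _ _ (by norm_num), ← mul_assoc]
      norm_num

theorem setLIntegral_Iio_energy_eq {s : ℝ} (hs : 0 < s) {a T : ℝ} (haT : a < T)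
    {g : ℝ → ℝ} (hg : Measurable g) (hga : ∀ t < a, g t = 0) :
    ∫⁻ t in Iio T, ∫⁻ τ in Iio t, ENNReal.ofReal ((g t - g τ) ^ 2 / |t - τ| ^ (1 + s)) =
      (∫⁻ t in Ioo a T, ∫⁻ τ in Ioo a t,
          ENNReal.ofReal ((g t - g τ) ^ 2 / |t - τ| ^ (1 + s)))
        + ENNReal.ofReal s⁻¹ *
          ∫⁻ t in Ioo a T, ENNReal.ofReal (g t ^ 2 * (t - a) ^ (-s)) := by
  have hzero : ∫⁻ t in Iio a, ∫⁻ τ in Iio t,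
      ENNReal.ofReal ((g t - g τ) ^ 2 / |t - τ| ^ (1 + s)) = 0 := by
    refine setLIntegral_eq_zero measurableSet_Iio fun t ht => ?_
    refine setLIntegral_eq_zero measurableSet_Iio fun τ hτ => ?_
    simp [hga t ht, hga τ (lt_trans hτ ht)]
  have hsplit := lintegral_inter_add_sdiff
    (fun t => ∫⁻ τ in Iio t, ENNReal.ofReal ((g t - g τ) ^ 2 / |t - τ| ^ (1 + s)))
    (Iio T) (measurableSet_Iio (a := a)) (μ := volume)
  rw [inter_eq_right.2 (Iio_subset_Iio haT.le), hzero, zero_add, sdiff_eq, compl_Iio,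
    inter_comm, Ici_inter_Iio, ← setLIntegral_congr (Ioo_ae_eq_Ico (μ := volume))] at hsplit
  rw [← hsplit, ← lintegral_const_mul _ (by fun_prop), ← lintegral_add_right _ (by fun_prop)]
  refine setLIntegral_congr_fun measurableSet_Ioo fun t ht => ?_
  have hin := lintegral_inter_add_sdiff
    (fun τ => ENNReal.ofReal ((g t - g τ) ^ 2 / |t - τ| ^ (1 + s)))
    (Iio t) (measurableSet_Iio (a := a)) (μ := volume)
  rw [inter_eq_right.2 (Iio_subset_Iio ht.1.le), sdiff_eq, compl_Iio,
    inter_comm, Ici_inter_Iio, ← setLIntegral_congr (Ioo_ae_eq_Ico (μ := volume))] at hin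
  rw [← hin, add_comm]
  congr 1
  calc ∫⁻ τ in Iio a, ENNReal.ofReal ((g t - g τ) ^ 2 / |t - τ| ^ (1 + s))
      = ∫⁻ τ in Iio a, ENNReal.ofReal (g t ^ 2) * ENNReal.ofReal ((t - τ) ^ (-(1 + s))) := by
        refine setLIntegral_congr_fun measurableSet_Iio fun τ hτ => ?_
        have hτt : 0 < t - τ := sub_pos.2 (lt_trans hτ ht.1)
        rw [← ENNReal.ofReal_mul (sq_nonneg _), hga τ hτ, sub_zero, abs_of_pos hτt,
          rpow_neg hτt.le, div_eq_mul_inv]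
    _ = _ := by
        rw [lintegral_const_mul' _ _ ENNReal.ofReal_ne_top, lintegral_Iio_sub_rpow hs ht.1,
          ← ENNReal.ofReal_mul (sq_nonneg _), ← ENNReal.ofReal_mul (by positivity)]
        congr 1
        ring

/-- **Lemma 2.3 (energy estimate for the even reflection).** For continuous `f : [a,T] → ℝ`,
the extension `F` obtained by extending by zero for `t < a` and reflecting evenly across `T`
satisfies `∫∫_{ℝ×ℝ} |F t - F τ|²/|t-τ|^{1+s} ≤ C(s) (∫_a^T ∫_a^t |f t - f τ|²/(t-τ)^{1+s}
 + ∫_a^T |f t|²/(T-t)^s)`. -/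
theorem even_reflection_energy_estimate (s : ℝ) (hs0 : 0 < s) (hs1 : s < 1) :
    ∃ C : ℝ, 0 < C ∧
      ∀ a T : ℝ, a < T → ∀ f : ℝ → ℝ, ContinuousOn f (Set.Icc a T) →
        (∫⁻ t, ∫⁻ τ, ENNReal.ofReal
            ((evenReflectExtend a T f t - evenReflectExtend a T f τ) ^ 2 /
              |t - τ| ^ (1 + s))) ≤
          ENNReal.ofReal C *
            ((∫⁻ t in Set.Ioo a T, ∫⁻ τ in Set.Ioo a t,
                ENNReal.ofReal ((f t - f τ) ^ 2 / (t - τ) ^ (1 + s)))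
              + ∫⁻ t in Set.Ioo a T, ENNReal.ofReal ((f t) ^ 2 / (T - t) ^ s)) := by
  have h1s : 0 < 1 - s := by linarith
  set k : ℝ := s⁻¹ * (2 * s / (1 - s)) with hk
  have hk0 : 0 < k := by positivity
  refine ⟨8 * (1 + k * ((1 + s) / (1 - s) + s⁻¹)), by positivity, fun a T haT f hf => ?_⟩
  set g : ℝ → ℝ := (Icc a T).indicator f with hgdef
  have hg : Measurable g := by
    classical
    have := hf.measurable_piecewise (g := 0) continuousOn_const measurableSet_Icc
    rwa [piecewise_eq_indicator] at this
  obtain ⟨M, hM⟩ : ∃ M, ∀ t, |g t| ≤ M := by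
    obtain ⟨M, hM⟩ := isCompact_Icc.exists_bound_of_continuousOn hf
    refine ⟨max M 0, fun t => ?_⟩
    by_cases ht : t ∈ Icc a T
    · rw [hgdef, indicator_of_mem ht]
      exact (hM t ht).trans (le_max_left _ _)
    · rw [hgdef, indicator_of_notMem ht, abs_zero]
      exact le_max_right _ _
  have hgf : ∀ t ∈ Ioo a T, g t = f t := fun t ht =>
    indicator_of_mem (Ioo_subset_Icc_self ht) f
  have hga : ∀ t < a, g t = 0 := fun t ht =>
    indicator_of_notMem (fun hm => ht.not_ge hm.1) f
  have hE : (∫⁻ t in Ioo a T, ∫⁻ τ in Ioo a t,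
        ENNReal.ofReal ((f t - f τ) ^ 2 / (t - τ) ^ (1 + s)))
      = ∫⁻ t in Ioo a T, ∫⁻ τ in Ioo a t,
        ENNReal.ofReal ((g t - g τ) ^ 2 / |t - τ| ^ (1 + s)) := by
    refine setLIntegral_congr_fun measurableSet_Ioo fun t ht => ?_
    refine setLIntegral_congr_fun measurableSet_Ioo fun τ hτ => ?_
    simp only [hgf t ht, hgf τ ⟨hτ.1, hτ.2.trans ht.2⟩, abs_of_pos (sub_pos.2 hτ.2)]
  have hB : ∫⁻ t in Ioo a T, ENNReal.ofReal ((f t) ^ 2 / (T - t) ^ s)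
      = ∫⁻ t in Ioo a T, ENNReal.ofReal (g t ^ 2 / (T - t) ^ s) :=
    setLIntegral_congr_fun measurableSet_Ioo fun t ht => by simp only [hgf t ht]
  have hhardy := hardy_left_endpoint_le hs0 hs1 haT hg hM
  have hfold := lintegral_energy_comp_reflection_le hs0 T g
  have htri := setLIntegral_symm_eq_two_mul (Iio T) (measurable_uncurry_energy_kernel s hg)
    fun t τ => by rw [abs_sub_comm, sub_sq_comm]
  have hIio : ∀ t ∈ Iio T, Iio T ∩ Iio t = Iio t := fun t ht =>
    inter_eq_right.2 (Iio_subset_Iio (le_of_lt ht))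
  have hbelow : ∫⁻ t in Iio T, ∫⁻ τ in Iio T ∩ Iio t,
        ENNReal.ofReal ((g t - g τ) ^ 2 / |t - τ| ^ (1 + s))
      = ∫⁻ t in Iio T, ∫⁻ τ in Iio t,
        ENNReal.ofReal ((g t - g τ) ^ 2 / |t - τ| ^ (1 + s)) :=
    setLIntegral_congr_fun measurableSet_Iio fun t ht => by simp only [hIio t ht]
  rw [hbelow, setLIntegral_Iio_energy_eq hs0 haT hg hga] at htri
  simp_rw [evenReflectExtend_eq_indicator haT.le, ← hgdef]
  rw [hE, hB]
  refine hfold.trans ?_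
  rw [htri]
  set E := ∫⁻ t in Ioo a T, ∫⁻ τ in Ioo a t,
    ENNReal.ofReal ((g t - g τ) ^ 2 / |t - τ| ^ (1 + s))
  set B := ∫⁻ t in Ioo a T, ENNReal.ofReal (g t ^ 2 / (T - t) ^ s)
  set A := ∫⁻ t in Ioo a T, ENNReal.ofReal (g t ^ 2 * (t - a) ^ (-s))
  have hA : ENNReal.ofReal s⁻¹ * A ≤
      ENNReal.ofReal (k * ((1 + s) / (1 - s) + s⁻¹)) * (E + B) := by
    calc ENNReal.ofReal s⁻¹ * A
        = ENNReal.ofReal k * (ENNReal.ofReal ((1 - s) / (2 * s)) * A) := by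
          rw [← mul_assoc, ← ENNReal.ofReal_mul hk0.le, hk]
          congr 2
          field_simp
      _ ≤ ENNReal.ofReal k * (ENNReal.ofReal ((1 + s) / (1 - s)) * E
            + ENNReal.ofReal s⁻¹ * B) := by gcongr
      _ ≤ ENNReal.ofReal k * (ENNReal.ofReal ((1 + s) / (1 - s)) * (E + B)
            + ENNReal.ofReal s⁻¹ * (E + B)) := by
          gcongr
          · exact le_self_add
          · exact le_add_self
      _ = _ := by
          rw [← add_mul, ← ENNReal.ofReal_add (by positivity) (by positivity), ← mul_assoc,
            ← ENNReal.ofReal_mul hk0.le]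
  calc 4 * (2 * (E + ENNReal.ofReal s⁻¹ * A))
      ≤ 4 * (2 * ((E + B) + ENNReal.ofReal (k * ((1 + s) / (1 - s) + s⁻¹)) * (E + B))) := by
        gcongr
        exact le_self_add
    _ = _ := by
        have hc : 0 ≤ k * ((1 + s) / (1 - s) + s⁻¹) := by positivity
        rw [ENNReal.ofReal_mul (p := 8) (by norm_num), ENNReal.ofReal_add zero_le_one hc,
          ENNReal.ofReal_one, ENNReal.ofReal_ofNat]
        ring

end
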